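/- Let n ≥ 10 and let C_1, …, C_{n−1} ∈ GL_r(ℂ) be an irreducible representation of B_n of dimension r with n+1 ≤ r ≤ 2n−9. Then there exists a nonzero complex number y such that rank(C_1 − y·I) ≤ r − n + 2. -/

import Mathlib

namespace BraidAux
open Module

structure Br {V : Type} [AddCommGroup V] [Module ℂ V] (m : ℕ) (C : ℕ → End ℂ V) : Prop where
  inj : ∀ i, 1 ≤ i → i < m → Function.Injective (C i)
  comm : ∀ i j, 1 ≤ i → i + 2 ≤ j → j < m → C i * C j = C j * C i
  braid : ∀ i, 1 ≤ i → i + 1 < m → C i * C (i+1) * C i = C (i+1) * C i * C (i+1)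

theorem eq_of_comm_braid {M : Type*} [Monoid M] {x y : M} (hx : IsUnit x) (hy : IsUnit y)
    (h : x * y = y * x) (hb : x * y * x = y * x * y) : x = y := by
  have h1 : y * (x * x) = y * (y * x) := by
    calc y * (x * x) = x * y * x := by rw [h, mul_assoc]
      _ = y * (x * y) := by rw [hb, mul_assoc]
      _ = _ := by rw [h]
  exact hx.mul_right_cancel (hy.mul_left_cancel h1)

variable {V : Type} [AddCommGroup V] [Module ℂ V]

theorem Br.unit [FiniteDimensional ℂ V] {m : ℕ} {C : ℕ → End ℂ V} (h : Br m C) (i : ℕ) (h1 : 1 ≤ i)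
    (h2 : i < m) : IsUnit (C i) :=
  (LinearMap.isUnit_iff_ker_eq_bot _).2 (LinearMap.ker_eq_bot.2 (h.inj i h1 h2))

theorem Br.comm' {m : ℕ} {C : ℕ → End ℂ V} (h : Br m C) (i j : ℕ) (hi : 1 ≤ i) (hi' : i < m)
    (hj : 1 ≤ j) (hj' : j < m) (hij : i + 2 ≤ j ∨ j + 2 ≤ i ∨ i = j) : C i * C j = C j * C i := by
  rcases hij with h1 | h1 | rfl
  · exact h.comm i j hi h1 hj'
  · exact (h.comm j i hj h1 hi').symm
  · rfl

theorem Br.shift {m : ℕ} {C : ℕ → End ℂ V} (h : Br (m+2) C) : Br m (fun i => C (i+2)) where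
  inj i h1 h2 := h.inj _ (by omega) (by omega)
  comm i j h1 h2 h3 := h.comm _ _ (by omega) (by omega) (by omega)
  braid i h1 h2 := by
    have := h.braid (i+2) (by omega) (by omega)
    rw [show i + 2 + 1 = i + 1 + 2 by omega] at this
    exact this

theorem Br.mono {m k : ℕ} {C : ℕ → End ℂ V} (h : Br m C) (hk : k ≤ m) : Br k C where
  inj i h1 h2 := h.inj _ (by omega) (by omega)
  comm i j h1 h2 h3 := h.comm _ _ (by omega) (by omega) (by omega)
  braid i h1 h2 := h.braid i (by omega) (by omega)

theorem Br.restr {m : ℕ} {C : ℕ → End ℂ V} (h : Br m C) (W : Submodule ℂ V)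
    (hW : ∀ i, 1 ≤ i → i < m → ∀ w ∈ W, C i w ∈ W) :
    ∃ C' : ℕ → End ℂ W, Br m C' ∧ ∀ i, 1 ≤ i → i < m → ∀ w : W, (C' i w : V) = C i w := by
  classical
  let C' : ℕ → End ℂ W := fun i =>
    if hi : ∀ w ∈ W, C i w ∈ W then (C i).restrict hi else 0
  have key : ∀ i, 1 ≤ i → i < m → ∀ w : W, (C' i w : V) = C i w := by
    intro i h1 h2 w
    have := hW i h1 h2
    simp only [C', dif_pos this]
    rfl
  refine ⟨C', ⟨?_, ?_, ?_⟩, key⟩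
  · intro i h1 h2 a b hab
    apply Subtype.ext
    apply h.inj i h1 h2
    rw [← key i h1 h2, ← key i h1 h2, hab]
  · intro i j h1 h2 h3
    ext w
    have := LinearMap.congr_fun (h.comm i j h1 h2 h3) (w : V)
    simp only [End.mul_apply] at this ⊢
    rw [key i h1 (by omega), key j (by omega) h3, key j (by omega) h3, key i h1 (by omega), this]
  · intro i h1 h2
    ext w
    have := LinearMap.congr_fun (h.braid i h1 h2) (w : V)
    simp only [End.mul_apply] at this ⊢
    simp only [key i h1 (by omega), key (i+1) (by omega) h2, this]

theorem Br.all_eq [FiniteDimensional ℂ V] {m : ℕ} {C : ℕ → End ℂ V} (h : Br m C) (i : ℕ)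
    (h1 : 1 ≤ i) (h2 : i + 1 < m) (he : C i = C (i+1)) :
    ∀ j k, 1 ≤ j → j < m → 1 ≤ k → k < m → C j = C k := by
  have up : ∀ d, i + d + 1 < m → C (i+d) = C (i+d+1) := by
    intro d
    induction d with
    | zero => intro _; exact he
    | succ d ih =>
      intro hd
      have e := ih (by omega)
      have c := h.comm (i+d) (i+d+1+1) (by omega) (by omega) hd
      rw [e] at c
      exact eq_of_comm_braid (h.unit _ (by omega) (by omega)) (h.unit _ (by omega) (by omega)) c
        (h.braid (i+d+1) (by omega) (by omega))
  have dn : ∀ d, d < i → C (i-d) = C (i-d+1) := by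
    intro d
    induction d with
    | zero => intro _; exact he
    | succ d ih =>
      intro hd
      have e := ih (by omega)
      obtain ⟨t, ht⟩ : ∃ t, i - d = t + 1 := ⟨i-d-1, by omega⟩
      rw [ht] at e
      rw [show i - (d+1) = t by omega]
      have c := h.comm t (t+1+1) (by omega) (by omega) (by omega)
      rw [← e] at c
      exact eq_of_comm_braid (h.unit _ (by omega) (by omega)) (h.unit _ (by omega) (by omega)) c
        (h.braid t (by omega) (by omega))
  have step : ∀ j, 1 ≤ j → j + 1 < m → C j = C (j+1) := by
    intro j hj hj'
    rcases le_total i j with hij | hij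
    · have := up (j-i) (by omega)
      rwa [show i + (j-i) = j by omega] at this
    · have := dn (i-j) (by omega)
      rwa [show i - (i-j) = j by omega] at this
  have one : ∀ j, 1 ≤ j → j < m → C j = C 1 := by
    intro j hj
    induction j, hj using Nat.le_induction with
    | base => intro _; rfl
    | succ j hj ih => intro hm; rw [← step j hj hm]; exact ih (by omega)
  intro j k a b c d
  rw [one j a b, one k c d]

/-- extension lemma -/
theorem Br.ext [FiniteDimensional ℂ V] {m : ℕ} {C : ℕ → End ℂ V} (h : Br m C) (hm : 5 ≤ m)
    (hD : ∀ i j k l, 1 ≤ i → i < m → 1 ≤ j → j < m → 1 ≤ k → k < m → 1 ≤ l → l < m →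
      (C i - C j) * (C k - C l) = 0) :
    ∀ j k, 1 ≤ j → j < m → 1 ≤ k → k < m → C j = C k := by
  refine h.all_eq 1 le_rfl (by omega) ?_
  have c1 := h.comm 1 4 (by omega) (by omega) (by omega)
  have c2 := h.comm 2 4 (by omega) (by omega) (by omega)
  have b := h.braid 1 (by omega) (by omega)
  have u := h.unit 4 (by omega) (by omega)
  have hD' : ∀ i j k l, 1 ≤ i → i < 5 → 1 ≤ j → j < 5 → 1 ≤ k → k < 5 → 1 ≤ l → l < 5 →
      (C i - C j) * (C k - C l) = 0 := by
    intros; apply hD <;> omega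
  norm_num at b
  show C 1 = C 2
  set c := C 4
  obtain ⟨N, hN⟩ : ∃ N, C 1 = c + N := ⟨C 1 - c, by abel⟩
  obtain ⟨P, hP⟩ : ∃ P, C 2 = c + P := ⟨C 2 - c, by abel⟩
  have n1 : N * N = 0 := by simpa [hN, c] using hD' 1 4 1 4
  have n2 : N * P = 0 := by simpa [hN, hP, c] using hD' 1 4 2 4
  have n3 : P * N = 0 := by simpa [hN, hP, c] using hD' 2 4 1 4
  have n4 : P * P = 0 := by simpa [hN, hP, c] using hD' 2 4 2 4
  rw [hN] at c1
  rw [hP] at c2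
  have e1 : N * c = c * N := by simpa [add_mul, mul_add] using c1
  have e2 : P * c = c * P := by simpa [add_mul, mul_add] using c2
  rw [hN, hP] at b
  have l : (c + N) * (c + P) * (c + N) = c*c*c + c*c*N + c*(P * c) + c * (P*N) + (N*c)*c + (N*c)*N + (N*P)*c + (N*P)*N := by noncomm_ring
  have r : (c + P) * (c + N) * (c + P) = c*c*c + c*c*P + c*(N * c) + c * (N*P) + (P*c)*c + (P*c)*P + (P*N)*c + (P*N)*P := by noncomm_ring
  have q1 : N * c * c = c * c * N := by rw [e1, mul_assoc, e1, mul_assoc]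
  have q2 : P * c * c = c * c * P := by rw [e2, mul_assoc, e2, mul_assoc]
  rw [l, r, q1, q2, e1, e2] at b
  simp only [mul_assoc, n1, n2, n3, n4, mul_zero, add_zero, zero_mul] at b
  have b' : c * (c * N) = c * (c * P) := by
    have : c * (c * c) + c * (c * N) + c * (c * P) + c * (c * N) = c * (c * c) + c * (c * N) + c * (c * P) + c * (c * P) := by
      rw [b]; abel
    exact add_left_cancel this
  rw [hN, hP, u.mul_left_cancel (u.mul_left_cancel b')]

theorem finrank_range_lt {f : End ℂ V} [FiniteDimensional ℂ V] (h : LinearMap.ker f ≠ ⊥) :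
    finrank ℂ (LinearMap.range f) < finrank ℂ V := by
  have := f.finrank_range_add_finrank_ker
  have : 0 < finrank ℂ (LinearMap.ker f) := by
    rw [Nat.pos_iff_ne_zero]
    intro h0
    exact h (Submodule.finrank_eq_zero.1 h0)
  omega

/-- gluing along eigenspaces -/
theorem glue (m : ℕ) (hm : 5 ≤ m) : ∀ (d : ℕ) (V : Type) [AddCommGroup V] [Module ℂ V]
    [FiniteDimensional ℂ V] (C : ℕ → End ℂ V) (f : End ℂ V), finrank ℂ V = d → Br m C →
    (∀ i, 1 ≤ i → i < m → f * C i = C i * f) →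
    (∀ μ : ℂ, ∀ v, f v = μ • v → ∀ i j, 1 ≤ i → i < m → 1 ≤ j → j < m → C i v = C j v) →
    ∀ i j, 1 ≤ i → i < m → 1 ≤ j → j < m → C i = C j := by
  intro d
  induction d using Nat.strong_induction_on with
  | _ d ih =>
  intro V _ _ _ C f hd hC hf hE
  rcases subsingleton_or_nontrivial V with hs | hs
  · intros; ext v; exact Subsingleton.elim _ _
  obtain ⟨μ, hμ⟩ := Module.End.exists_eigenvalue f
  set g : End ℂ V := f - μ • 1 with hg
  have hgC : ∀ i, 1 ≤ i → i < m → g * C i = C i * g := by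
    intro i h1 h2
    simp [hg, sub_mul, mul_sub, hf i h1 h2]
  have hker : LinearMap.ker g ≠ ⊥ := by
    obtain ⟨v, hv⟩ := hμ.exists_hasEigenvector
    intro h0
    apply hv.2
    have : v ∈ LinearMap.ker g := by
      simp [hg, hv.apply_eq_smul]
    rw [h0] at this
    simpa using this
  set W := LinearMap.range g
  have hWlt : finrank ℂ W < finrank ℂ V := finrank_range_lt hker
  have hWC : ∀ i, 1 ≤ i → i < m → ∀ w ∈ W, C i w ∈ W := by
    rintro i h1 h2 _ ⟨v, rfl⟩
    exact ⟨C i v, LinearMap.congr_fun (hgC i h1 h2) v⟩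
  obtain ⟨C', hC', hcc⟩ := hC.restr W hWC
  have hfW : ∀ w ∈ W, f w ∈ W := by
    rintro _ ⟨v, rfl⟩
    refine ⟨f v, ?_⟩
    simp [hg]
  have hW := ih (finrank ℂ W) (by omega) W C' (f.restrict hfW) rfl hC'
    (by
      intro i h1 h2
      ext w
      have := LinearMap.congr_fun (hf i h1 h2) w
      simp only [End.mul_apply] at this ⊢
      rw [hcc i h1 h2]
      show f (C' i w) = C i (f w)
      rw [hcc i h1 h2, this])
    (by
      intro ν w hw i j h1 h2 h3 h4
      apply Subtype.ext
      rw [hcc i h1 h2, hcc j h3 h4]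
      refine hE ν w ?_ i j h1 h2 h3 h4
      exact congrArg Subtype.val hw)
  have hDg : ∀ i j, 1 ≤ i → i < m → 1 ≤ j → j < m → ∀ v, C i (g v) = C j (g v) := by
    intro i j h1 h2 h3 h4 v
    have := congrArg Subtype.val (LinearMap.congr_fun (hW i j h1 h2 h3 h4) ⟨g v, ⟨v, rfl⟩⟩)
    rwa [hcc i h1 h2, hcc j h3 h4] at this
  refine hC.ext hm ?_
  intro i j k l a1 a2 a3 a4 a5 a6 a7 a8
  ext v
  have hgD : g ((C k - C l) v) = 0 := by
    have e1 := LinearMap.congr_fun (hgC k a5 a6) v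
    have e2 := LinearMap.congr_fun (hgC l a7 a8) v
    simp only [End.mul_apply] at e1 e2
    have e3 : g ((C k - C l) v) = g (C k v) - g (C l v) := by rw [← map_sub]; rfl
    rw [e3, e1, e2, hDg k l a5 a6 a7 a8, sub_self]
  have : f ((C k - C l) v) = μ • ((C k - C l) v) := by
    rw [hg] at hgD
    simpa [sub_eq_zero] using hgD
  have := hE μ _ this i j a1 a2 a3 a4
  rw [End.mul_apply, LinearMap.sub_apply, this, sub_self]; rfl

theorem aeval_coe {W : Submodule ℂ V} (f : End ℂ V) (f' : End ℂ W) (h : ∀ w : W, (f' w : V) = f w)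
    (p : Polynomial ℂ) : ∀ w : W, (Polynomial.aeval f' p w : V) = Polynomial.aeval f p (w : V) := by
  induction p using Polynomial.induction_on' with
  | add p q hp hq => intro w; simp [hp, hq]
  | monomial n a =>
    have : ∀ n : ℕ, ∀ w : W, ((f' ^ n) w : V) = (f ^ n) (w : V) := by
      intro n
      induction n with
      | zero => intro w; rfl
      | succ n ih => intro w; rw [pow_succ, pow_succ, End.mul_apply, End.mul_apply, ih, h]
    intro w
    simp [Polynomial.aeval_monomial, this, Module.algebraMap_end_apply]

/-- commutant of a nonderogatory operator -/
theorem commutant : ∀ (d : ℕ) (V : Type) [AddCommGroup V] [Module ℂ V]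
    [FiniteDimensional ℂ V] (f x : End ℂ V), finrank ℂ V = d → f * x = x * f →
    (∀ μ : ℂ, finrank ℂ (LinearMap.ker (f - μ • (1 : End ℂ V))) ≤ 1) →
    ∃ p : Polynomial ℂ, x = Polynomial.aeval f p := by
  intro d
  induction d using Nat.strong_induction_on with
  | _ d ih =>
  intro V _ _ _ f x hd hx hE
  rcases subsingleton_or_nontrivial V with hs | hs
  · exact ⟨0, by ext v; exact Subsingleton.elim _ _⟩
  obtain ⟨μ, hμ⟩ := Module.End.exists_eigenvalue f
  obtain ⟨g, hg⟩ : ∃ g : End ℂ V, g = f - μ • 1 := ⟨_, rfl⟩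
  have hgx : g * x = x * g := by
    simp [hg, sub_mul, mul_sub, hx]
  have hker : LinearMap.ker g ≠ ⊥ := by
    obtain ⟨v, hv⟩ := hμ.exists_hasEigenvector
    intro h0
    apply hv.2
    have : v ∈ LinearMap.ker g := by
      simp [hg, hv.apply_eq_smul]
    rw [h0] at this
    simpa using this
  obtain ⟨W, hWdef⟩ : ∃ W, W = LinearMap.range g := ⟨_, rfl⟩
  have hWlt : finrank ℂ W < finrank ℂ V := hWdef ▸ finrank_range_lt hker
  have hEg : finrank ℂ (LinearMap.ker g) ≤ 1 := hg ▸ hE μ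
  have hWge : finrank ℂ V ≤ finrank ℂ W + 1 := by
    have := g.finrank_range_add_finrank_ker
    rw [← hWdef] at this
    omega
  have hxW : ∀ w ∈ W, x w ∈ W := by
    subst hWdef
    rintro _ ⟨v, rfl⟩
    exact ⟨x v, LinearMap.congr_fun hgx v⟩
  have hfW : ∀ w ∈ W, f w ∈ W := by
    subst hWdef
    rintro _ ⟨v, rfl⟩
    refine ⟨f v, ?_⟩
    simp [hg]
  obtain ⟨p, hp⟩ := ih (finrank ℂ W) (by omega) W (f.restrict hfW) (x.restrict hxW) rfl
    (by
      ext w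
      exact LinearMap.congr_fun hx w)
    (by
      intro ν
      refine le_trans ?_ (hE ν)
      let φ : LinearMap.ker (f.restrict hfW - ν • (1 : End ℂ W)) →ₗ[ℂ]
          LinearMap.ker (f - ν • (1 : End ℂ V)) :=
        LinearMap.codRestrict _ (W.subtype ∘ₗ Submodule.subtype _) (by
          rintro ⟨w, hw⟩
          rw [LinearMap.mem_ker] at hw ⊢
          exact congrArg Subtype.val hw)
      refine LinearMap.finrank_le_finrank_of_injective (f := φ) ?_
      intro a b hab
      apply Subtype.ext
      apply Subtype.ext
      have h2 : (φ a : V) = (φ b : V) := by rw [hab]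
      exact h2)
  have hpW : ∀ w ∈ W, x w = Polynomial.aeval f p w := by
    intro w hw
    have := congrArg Subtype.val (LinearMap.congr_fun hp ⟨w, hw⟩)
    rw [aeval_coe f _ (fun _ => rfl)] at this
    exact this
  obtain ⟨z, hz⟩ : ∃ z, z = x - Polynomial.aeval f p := ⟨_, rfl⟩
  have hfp : f * Polynomial.aeval f p = Polynomial.aeval f p * f := by
    have := Polynomial.aeval_mul (p := Polynomial.X) (q := p) (x := f)
    rw [mul_comm, Polynomial.aeval_mul] at this
    simpa using this.symm
  have hgz : g * z = z * g := by
    simp [hg, hz, sub_mul, mul_sub, hx, hfp, smul_sub]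
    abel
  have hzW : ∀ w ∈ W, z w = 0 := by
    intro w hw; rw [hz, LinearMap.sub_apply, hpW w hw, sub_self]
  have hroot : (minpoly ℂ f).IsRoot μ := Module.End.isRoot_of_hasEigenvalue hμ
  obtain ⟨q, hq⟩ := Polynomial.dvd_iff_isRoot.2 hroot
  have hint : IsIntegral ℂ f := Algebra.IsIntegral.isIntegral f
  have hq0 : q ≠ 0 := by
    rintro rfl
    rw [mul_zero] at hq
    exact minpoly.ne_zero hint hq
  have hQ : Polynomial.aeval f q ≠ 0 := by
    intro h0
    have h1 := minpoly.degree_le_of_ne_zero ℂ f hq0 h0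
    rw [Polynomial.degree_eq_natDegree hq0, Polynomial.degree_eq_natDegree (minpoly.ne_zero hint),
      hq, Polynomial.natDegree_mul (Polynomial.X_sub_C_ne_zero μ) hq0,
      Polynomial.natDegree_X_sub_C] at h1
    have := WithBot.coe_le_coe.1 h1
    simp at this
  obtain ⟨Q, hQdef⟩ : ∃ Q, Q = Polynomial.aeval f q := ⟨_, rfl⟩
  rw [← hQdef] at hQ
  have hXg : Polynomial.aeval f (Polynomial.X - Polynomial.C μ) = g := by
    simp [hg, Algebra.algebraMap_eq_smul_one]
  have hgQ : g * Q = 0 := by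
    have := minpoly.aeval ℂ f
    rw [hq, Polynomial.aeval_mul, hXg, ← hQdef] at this
    exact this
  have hQg : Q * g = 0 := by
    have := minpoly.aeval ℂ f
    rw [hq, mul_comm, Polynomial.aeval_mul, hXg, ← hQdef] at this
    exact this
  have hQW : ∀ w ∈ W, Q w = 0 := by
    subst hWdef
    rintro _ ⟨v, rfl⟩
    exact LinearMap.congr_fun hQg v
  obtain ⟨v, hv⟩ : ∃ v, Q v ≠ 0 := by
    by_contra! h
    exact hQ (LinearMap.ext h)
  have hzv : g (z v) = 0 := by
    have := LinearMap.congr_fun hgz v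
    simp only [End.mul_apply] at this
    rw [this]
    exact hzW _ (hWdef ▸ ⟨v, rfl⟩)
  have hQv : g (Q v) = 0 := LinearMap.congr_fun hgQ v
  have h1 : finrank ℂ (LinearMap.ker g) = 1 := by
    have := g.finrank_range_add_finrank_ker
    rw [← hWdef] at this
    omega
  obtain ⟨c, hc⟩ := (finrank_eq_one_iff_of_nonzero' (⟨Q v, hQv⟩ : LinearMap.ker g)
    (by intro h; exact hv (congrArg Subtype.val h))).1 h1 ⟨z v, hzv⟩
  have hc' : c • Q v = z v := congrArg Subtype.val hc
  have hfin : z - c • Q = 0 := by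
    rw [← LinearMap.ker_eq_top]
    apply Submodule.eq_top_of_finrank_eq
    apply le_antisymm (Submodule.finrank_le _)
    have hlt : W < LinearMap.ker (z - c • Q) := by
      refine lt_of_le_of_ne ?_ ?_
      · intro w hw
        simp [hzW w hw, hQW w hw]
      · intro h
        apply hv
        apply hQW
        rw [h]
        simp [hc']
    have := Submodule.finrank_lt_finrank_of_lt hlt
    omega
  refine ⟨p + Polynomial.C c * q, ?_⟩
  have : x = Polynomial.aeval f p + c • Q := by
    rw [← sub_eq_zero, ← sub_sub, ← hz, hfin]
  rw [this, map_add, Polynomial.aeval_mul, Polynomial.aeval_C, ← hQdef]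
  simp [Algebra.algebraMap_eq_smul_one]

theorem commutant_comm [FiniteDimensional ℂ V] (f x y : End ℂ V) (hx : f * x = x * f)
    (hy : f * y = y * f)
    (hE : ∀ μ : ℂ, finrank ℂ (LinearMap.ker (f - μ • (1 : End ℂ V))) ≤ 1) : x * y = y * x := by
  obtain ⟨p, rfl⟩ := commutant _ V f x rfl hx hE
  obtain ⟨q, rfl⟩ := commutant _ V f y rfl hy hE
  rw [← Polynomial.aeval_mul, mul_comm, Polynomial.aeval_mul]

def Aop (C : ℕ → End ℂ V) (y : ℂ) (i : ℕ) : End ℂ V := C i - y • 1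

theorem Aop_sub (C : ℕ → End ℂ V) (y : ℂ) (i j : ℕ) : Aop C y i - Aop C y j = C i - C j := by
  simp [Aop]

theorem A_comm_C {C : ℕ → End ℂ V} {y : ℂ} {i j : ℕ} (h : C i * C j = C j * C i) :
    Aop C y i * C j = C j * Aop C y i := by
  simp [Aop, sub_mul, mul_sub, h]

theorem A_comm_A {C : ℕ → End ℂ V} {y : ℂ} {i j : ℕ} (h : C i * C j = C j * C i) :
    Aop C y i * Aop C y j = Aop C y j * Aop C y i := by
  have := A_comm_C (y := y) h
  conv_lhs => rw [Aop.eq_1 C y j]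
  conv_rhs => rw [Aop.eq_1 C y j]
  simp [sub_mul, mul_sub, this]

theorem rank_le_of_conj [FiniteDimensional ℂ V] {x z P : End ℂ V} (hP : IsUnit P)
    (h : x * P = P * z) : finrank ℂ (LinearMap.range x) ≤ finrank ℂ (LinearMap.range z) := by
  have h1 : LinearMap.range x ≤ (LinearMap.range z).map P := by
    rintro _ ⟨v, rfl⟩
    obtain ⟨u, hu⟩ := hP.exists_right_inv
    refine ⟨z (u v), ⟨_, rfl⟩, ?_⟩
    have e := LinearMap.congr_fun h (u v)
    have e2 := LinearMap.congr_fun hu v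
    simp only [End.mul_apply, End.one_apply] at e e2
    rw [← e, e2]
  exact (Submodule.finrank_mono h1).trans (Submodule.finrank_map_le _ _)

theorem conj_up {C : ℕ → End ℂ V} {y : ℂ} {i j : ℕ} (h : C i * C j * C i = C j * C i * C j) :
    Aop C y j * (C i * C j) = (C i * C j) * Aop C y i := by
  simp [Aop, sub_mul, mul_sub, h, ← mul_assoc]

theorem Br.rank_eq [FiniteDimensional ℂ V] {m : ℕ} {C : ℕ → End ℂ V} (h : Br m C) (y : ℂ) (i : ℕ)
    (h1 : 1 ≤ i) : i < m → finrank ℂ (LinearMap.range (Aop C y i)) =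
      finrank ℂ (LinearMap.range (Aop C y 1)) := by
  induction i, h1 using Nat.le_induction with
  | base => intro _; rfl
  | succ i hi ih =>
    intro hm
    rw [← ih (by omega)]
    have u1 := h.unit i hi (by omega)
    have u2 := h.unit (i+1) (by omega) (by omega)
    have b := h.braid i hi hm
    exact le_antisymm (rank_le_of_conj (u1.mul u2) (conj_up b))
      (rank_le_of_conj (u2.mul u1) (conj_up b.symm))

theorem tlem [FiniteDimensional ℂ V] {m : ℕ} {C : ℕ → End ℂ V} (h : Br m C) (hm : 6 ≤ m) (y : ℂ)
    (H1 : ∀ i j, 3 ≤ i → i < m → 3 ≤ j → j < m → (C i - C j) * Aop C y 1 = 0)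
    (H2 : ∀ i j, 1 ≤ i → i + 2 < m → 1 ≤ j → j + 2 < m → (C i - C j) * Aop C y (m-1) = 0) :
    ∃ T : End ℂ V, (∀ k, 1 ≤ k → k < m → T * C k = C k * T) ∧
      (∀ i j, 1 ≤ i → i < m → 1 ≤ j → j < m → (C i - C j) * T = 0) ∧
      (T = 0 → ∀ i j, 1 ≤ i → i + 2 ≤ j → j < m → Aop C y i * Aop C y j = 0) := by
  obtain ⟨A, hA⟩ : ∃ A, A = Aop C y := ⟨_, rfl⟩
  rw [← hA] at H1 H2 ⊢
  have cAA : ∀ i j, 1 ≤ i → i < m → 1 ≤ j → j < m → (i + 2 ≤ j ∨ j + 2 ≤ i ∨ i = j) →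
      A i * A j = A j * A i := by
    intro i j a b c d e
    rw [hA]; exact A_comm_A (h.comm' i j a b c d e)
  have cAC : ∀ i j, 1 ≤ i → i < m → 1 ≤ j → j < m → (i + 2 ≤ j ∨ j + 2 ≤ i ∨ i = j) →
      A i * C j = C j * A i := by
    intro i j a b c d e
    rw [hA]; exact A_comm_C (h.comm' i j a b c d e)
  have hsub : ∀ i j, A i - A j = C i - C j := by rw [hA]; exact Aop_sub C y
  obtain ⟨T, hT⟩ : ∃ T, T = A 3 * A 1 := ⟨_, rfl⟩
  have e1 : ∀ i, 3 ≤ i → i < m → T = A i * A 1 := by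
    intro i hi hi'
    have := H1 3 i le_rfl (by omega) hi hi'
    rw [← hsub, sub_mul, sub_eq_zero] at this
    rw [hT, this]
  have e2 : ∀ j, 1 ≤ j → j + 2 < m → T = A j * A (m-1) := by
    intro i hi hi'
    have := H2 1 i le_rfl (by omega) hi hi'
    rw [← hsub, sub_mul, sub_eq_zero] at this
    rw [← this, e1 (m-1) (by omega) (by omega)]
    exact cAA _ _ (by omega) (by omega) (by omega) (by omega) (by omega)
  have prodcomm : ∀ i j k, 1 ≤ i → i < m → 1 ≤ j → j < m → 1 ≤ k → k < m →
      (i + 2 ≤ k ∨ k + 2 ≤ i ∨ i = k) → (j + 2 ≤ k ∨ k + 2 ≤ j ∨ j = k) →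
      A i * A j * C k = C k * (A i * A j) := by
    intro i j k a1 a2 a3 a4 a5 a6 a7 a8
    rw [mul_assoc, cAC j k a3 a4 a5 a6 a8, ← mul_assoc, cAC i k a1 a2 a5 a6 a7, mul_assoc]
  refine ⟨T, ?_, ?_, ?_⟩
  · intro k k1 k2
    by_cases h2 : k = 2
    · rw [e2 2 (by omega) (by omega)]
      exact prodcomm _ _ _ (by omega) (by omega) (by omega) (by omega) (by omega) (by omega)
        (by omega) (by omega)
    by_cases h1 : k = 1
    · rw [e1 3 (by omega) (by omega)]
      exact prodcomm _ _ _ (by omega) (by omega) (by omega) (by omega) (by omega) (by omega)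
        (by omega) (by omega)
    · rw [e1 k (by omega) (by omega)]
      exact prodcomm _ _ _ (by omega) (by omega) (by omega) (by omega) (by omega) (by omega)
        (by omega) (by omega)
  · have key : ∀ i, 1 ≤ i → i < m → C i * T = C 3 * T := by
      intro i a b
      rw [← sub_eq_zero, ← sub_mul]
      by_cases hi : 3 ≤ i
      · rw [hT, cAA 3 1 (by omega) (by omega) (by omega) (by omega) (by omega), ← mul_assoc,
          H1 i 3 hi b (by omega) (by omega), zero_mul]
      · rw [e1 (m-1) (by omega) (by omega), ← mul_assoc,
          H2 i 3 a (by omega) (by omega) (by omega), zero_mul]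
    intro i j a b c d
    rw [sub_mul, key i a b, key j c d, sub_self]
  · intro hT0 i j hi
    induction i, hi using Nat.le_induction generalizing j with
    | base =>
      intro a b
      rw [cAA _ _ (by omega) (by omega) (by omega) (by omega) (by omega), ← e1 j (by omega) b, hT0]
    | succ i hi ih =>
      intro a b
      have z := ih j (by omega) b
      have cu := conj_up (y := y) (h.braid i hi (by omega))
      rw [← hA] at cu
      have u := (h.unit i hi (by omega)).mul (h.unit (i+1) (by omega) (by omega))
      have c1 := cAC j i (by omega) b (by omega) (by omega) (by omega)
      have c2 := cAC j (i+1) (by omega) b (by omega) (by omega) (by omega)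
      have c3 : A j * (C i * C (i+1)) = (C i * C (i+1)) * A j := by
        rw [← mul_assoc, c1, mul_assoc, c2, mul_assoc]
      apply u.mul_right_cancel
      rw [mul_assoc, c3, ← mul_assoc, cu, mul_assoc, z, mul_zero, zero_mul]

def MM (A : ℕ → End ℂ V) : ℕ → Submodule ℂ V
  | 0 => ⊥
  | j + 1 => MM A j ⊔ LinearMap.range (A (j+1))

theorem MM_le {A : ℕ → End ℂ V} {U : Submodule ℂ V} (j : ℕ)
    (h : ∀ i, 1 ≤ i → i ≤ j → LinearMap.range (A i) ≤ U) : MM A j ≤ U := by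
  induction j with
  | zero => exact bot_le
  | succ j ih => exact sup_le (ih fun i a b => h i a (by omega)) (h _ (by omega) le_rfl)

theorem le_MM {A : ℕ → End ℂ V} (i j : ℕ) (hi : 1 ≤ i) (hij : i ≤ j) :
    LinearMap.range (A i) ≤ MM A j := by
  induction j with
  | zero => omega
  | succ j ih =>
    rcases Nat.lt_or_ge j i with h | h
    · obtain rfl : i = j + 1 := by omega
      exact le_sup_right
    · exact (ih h).trans le_sup_left

theorem MM_kill {A : ℕ → End ℂ V} (i j : ℕ) (h : ∀ k, 1 ≤ k → k ≤ j → A i * A k = 0) :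
    ∀ v ∈ MM A j, A i v = 0 := by
  have : MM A j ≤ LinearMap.ker (A i) := by
    apply MM_le
    rintro k a b _ ⟨v, rfl⟩
    exact LinearMap.congr_fun (h k a b) v
  exact this

theorem braid_A (C : ℕ → End ℂ V) (y : ℂ) (i j : ℕ) (h : C i * C j * C i = C j * C i * C j) :
    Aop C y i * Aop C y j * Aop C y i + y • (Aop C y i * C i) =
    Aop C y j * Aop C y i * Aop C y j + y • (Aop C y j * C j) := by
  obtain ⟨a, ha⟩ : ∃ a, a = Aop C y i := ⟨_, rfl⟩
  obtain ⟨b, hb⟩ : ∃ b, b = Aop C y j := ⟨_, rfl⟩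
  have ha' : C i = a + y • 1 := by simp [ha, Aop]
  have hb' : C j = b + y • 1 := by simp [hb, Aop]
  rw [← ha, ← hb]
  rw [ha', hb'] at h ⊢
  simp only [add_mul, mul_add, smul_mul_assoc, mul_smul_comm, one_mul, mul_one, smul_add] at h ⊢
  rw [← sub_eq_zero] at h ⊢
  rw [← h]
  module

theorem chain [FiniteDimensional ℂ V] {m : ℕ} {C : ℕ → End ℂ V} (h : Br m C) {y : ℂ} (hy : y ≠ 0)
    (hfar : ∀ i j, 1 ≤ i → i + 2 ≤ j → j < m → Aop C y i * Aop C y j = 0) (K : ℕ) (hK1 : 1 ≤ K)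
    (hK : K < m) :
    finrank ℂ (LinearMap.range (Aop C y 1)) + K ≤ finrank ℂ (MM (Aop C y) K) + 1 ∨
    ∃ j, 1 ≤ j ∧ j < K ∧ MM (Aop C y) j = MM (Aop C y) (m-1) := by
  obtain ⟨A, hA⟩ : ∃ A, A = Aop C y := ⟨_, rfl⟩
  rw [← hA] at hfar ⊢
  have hfar' : ∀ i j, 1 ≤ i → i + 2 ≤ j → j < m → A j * A i = 0 := by
    intro i j a b c
    rw [hA, ← A_comm_A (h.comm i j a b c), ← hA, hfar i j a b c]
  by_cases hs : ∃ j, 1 ≤ j ∧ j < K ∧ LinearMap.range (A (j+1)) ≤ MM A j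
  · right
    obtain ⟨j, hj, hjK, hr⟩ := hs
    refine ⟨j, hj, hjK, le_antisymm ?_ ?_⟩
    · exact MM_le _ fun i a b => le_MM i _ a (by omega)
    · apply MM_le
      intro i hi him
      rcases Nat.lt_or_ge j i with hji | hji
      · have hji : j + 1 ≤ i := hji
        clear hi
        induction i, hji using Nat.le_induction with
        | base => exact hr
        | succ i hi ih =>
          have ih := ih (by omega) (by omega)
          refine le_trans ?_ ih
          have z : A (i+1) * A i = 0 := by
            ext v
            exact MM_kill (i+1) j (fun k a b => hfar' k (i+1) a (by omega) (by omega)) _ (ih ⟨v, rfl⟩)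
          have br := braid_A C y i (i+1) (h.braid i (by omega) (by omega))
          rw [← hA, mul_assoc, z, mul_zero, zero_mul, zero_add, zero_add] at br
          have br' : A i * C i = A (i+1) * C (i+1) := smul_right_injective _ hy br
          rintro _ ⟨v, rfl⟩
          obtain ⟨u, hu⟩ := (h.unit (i+1) (by omega) (by omega)).exists_right_inv
          refine ⟨C i (u v), ?_⟩
          have e1 := LinearMap.congr_fun br' (u v)
          have e2 := LinearMap.congr_fun hu v
          simp only [End.mul_apply, End.one_apply] at e1 e2
          rw [e1, e2]
      · exact le_MM i j hi hji
  · left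
    push Not at hs
    clear hK
    induction K, hK1 using Nat.le_induction with
    | base =>
      have : MM A 1 = LinearMap.range (A 1) := by simp [MM]
      rw [this]
    | succ K hK ih =>
      have := ih (fun j a b => hs j a (by omega))
      have hlt : MM A K < MM A (K+1) := by
        refine lt_of_le_of_ne le_sup_left ?_
        intro he
        apply hs K hK (by omega)
        rw [he]
        exact le_sup_right
      have := Submodule.finrank_lt_finrank_of_lt hlt
      omega

def Small (m : ℕ) : Prop := ∀ (V : Type) [AddCommGroup V] [Module ℂ V]
    [FiniteDimensional ℂ V] (C : ℕ → End ℂ V), Br m C → finrank ℂ V + 3 ≤ m →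
    ∀ i j, 1 ≤ i → i < m → 1 ≤ j → j < m → C i = C j

theorem Small.sub [FiniteDimensional ℂ V] {m : ℕ} (hS : Small m) {C : ℕ → End ℂ V} (h : Br m C)
    (W : Submodule ℂ V) (hW : ∀ i, 1 ≤ i → i < m → ∀ w ∈ W, C i w ∈ W)
    (hd : finrank ℂ W + 3 ≤ m) : ∀ w ∈ W, ∀ i j, 1 ≤ i → i < m → 1 ≤ j → j < m → C i w = C j w := by
  obtain ⟨C', hC', hcc⟩ := h.restr W hW
  intro w hw i j a b c d
  have := congrArg Subtype.val (LinearMap.congr_fun (hS W C' hC' hd i j a b c d) ⟨w, hw⟩)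
  rwa [hcc i a b, hcc j c d] at this

theorem H12 [FiniteDimensional ℂ V] {k : ℕ} (hS : Small k) {C : ℕ → End ℂ V} (h : Br (k+2) C)
    (hk : 1 ≤ k) (y : ℂ) (hr : finrank ℂ (LinearMap.range (Aop C y 1)) + 3 ≤ k) :
    (∀ i j, 3 ≤ i → i < k+2 → 3 ≤ j → j < k+2 → (C i - C j) * Aop C y 1 = 0) ∧
    (∀ i j, 1 ≤ i → i + 2 < k+2 → 1 ≤ j → j + 2 < k+2 → (C i - C j) * Aop C y (k+2-1) = 0) := by
  have inv : ∀ l i, C l * C i = C i * C l → ∀ w ∈ LinearMap.range (Aop C y l),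
      C i w ∈ LinearMap.range (Aop C y l) := by
    rintro l i hc _ ⟨v, rfl⟩
    exact ⟨C i v, LinearMap.congr_fun (A_comm_C (y := y) hc) v⟩
  constructor
  · intro i j a b c d
    ext v
    have := hS.sub h.shift (LinearMap.range (Aop C y 1))
      (fun i a b => inv 1 (i+2) (h.comm' _ _ (by omega) (by omega) (by omega) (by omega) (by omega)))
      hr (Aop C y 1 v) ⟨v, rfl⟩ (i-2) (j-2) (by omega) (by omega) (by omega) (by omega)
    simp only [show i - 2 + 2 = i by omega, show j - 2 + 2 = j by omega] at this
    simp [this]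
  · intro i j a b c d
    ext v
    have := hS.sub (h.mono (show k ≤ k + 2 by omega)) (LinearMap.range (Aop C y (k+2-1)))
      (fun i a b => inv _ i (h.comm' _ _ (by omega) (by omega) (by omega) (by omega) (by omega)))
      (by rw [h.rank_eq y (k+2-1) (by omega) (by omega)]; exact hr)
      (Aop C y (k+2-1) v) ⟨v, rfl⟩ i j (by omega) (by omega) (by omega) (by omega)
    rw [End.mul_apply, LinearMap.sub_apply, this, sub_self]; rfl

theorem eq_smul_of_rank {x : End ℂ V} [FiniteDimensional ℂ V]
    (h : finrank ℂ (LinearMap.range x) = 0) : x = 0 :=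
  LinearMap.range_eq_bot.1 (Submodule.finrank_eq_zero.1 h)

theorem all_eq_of_zero [FiniteDimensional ℂ V] {m : ℕ} {C : ℕ → End ℂ V} (h : Br m C) (hm : 3 ≤ m)
    {y : ℂ} (h0 : Aop C y 1 = 0) : ∀ i j, 1 ≤ i → i < m → 1 ≤ j → j < m → C i = C j := by
  have e : C 1 = y • 1 := sub_eq_zero.1 h0
  refine h.all_eq 1 le_rfl (by omega) ?_
  refine eq_of_comm_braid (h.unit _ le_rfl (by omega)) (h.unit _ (by omega) (by omega)) ?_
    (h.braid 1 le_rfl (by omega))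
  simp [e]

theorem Br.all_eq' [FiniteDimensional ℂ V] {m d : ℕ} {C : ℕ → End ℂ V} (h : Br m C)
    (hdm : d + 3 ≤ m) (hd1 : d ≤ 1) (hd : finrank ℂ V = d) :
    ∀ i j, 1 ≤ i → i < m → 1 ≤ j → j < m → C i = C j := by
  refine h.all_eq 1 le_rfl (by omega) ?_
  refine eq_of_comm_braid (h.unit _ le_rfl (by omega)) (h.unit _ (by omega) (by omega)) ?_
    (h.braid 1 le_rfl (by omega))
  refine commutant_comm 0 _ _ (by simp) (by simp) ?_
  intro μ
  exact (Submodule.finrank_le _).trans (by omega)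

theorem small (m : ℕ) : Small m := by
  induction m using Nat.strong_induction_on with
  | _ m ihm =>
  suffices H : ∀ (d : ℕ) (V : Type) [AddCommGroup V] [Module ℂ V]
    [FiniteDimensional ℂ V] (C : ℕ → End ℂ V), Br m C → finrank ℂ V = d → d + 3 ≤ m →
    ∀ i j, 1 ≤ i → i < m → 1 ≤ j → j < m → C i = C j from
    fun V _ _ _ C hC hd => H _ V C hC rfl hd
  intro d
  induction d using Nat.strong_induction_on with
  | _ d ihd =>
  intro V _ _ _ C h hd hdm
  by_cases hd1 : d ≤ 1
  · refine h.all_eq' hdm hd1 hd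
  have hm : 5 ≤ m := by omega
  by_cases hbig : ∃ y : ℂ, y ≠ 0 ∧ finrank ℂ (LinearMap.range (Aop C y 1)) + 5 ≤ m
  · obtain ⟨y, hy, hrk⟩ := hbig
    by_cases hr0 : finrank ℂ (LinearMap.range (Aop C y 1)) = 0
    · exact all_eq_of_zero h (by omega) (eq_smul_of_rank hr0)
    have hm6 : 6 ≤ m := by omega
    obtain ⟨k, rfl⟩ : ∃ k, m = k + 2 := ⟨m-2, by omega⟩
    obtain ⟨H1, H2⟩ := H12 (ihm k (by omega)) h (by omega) y (by omega)
    obtain ⟨T, hT1, hT2, hT3⟩ := tlem h hm6 y H1 H2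
    by_cases hT0 : T = 0
    · have hfar := hT3 hT0
      rcases chain h hy hfar k (by omega) (by omega) with hc | ⟨j, hj1, hj2, hj⟩
      · have := Submodule.finrank_le (MM (Aop C y) k)
        omega
      · have kill : ∀ t, t < k + 1 → ∀ v ∈ MM (Aop C y) (k+2-1), Aop C y (k+1-t) v = 0 := by
          intro t
          induction t with
          | zero =>
            intro _
            rw [← hj]
            apply MM_kill
            intro l l1 l2
            rw [← A_comm_A (h.comm l _ l1 (by omega) (by omega))]
            exact hfar l _ l1 (by omega) (by omega)
          | succ t ih =>
            intro ht v hv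
            have ih := ih (by omega)
            obtain ⟨s, hs⟩ : ∃ s, k + 1 - t = s + 1 := ⟨k-t, by omega⟩
            rw [hs] at ih
            rw [show k + 1 - (t+1) = s by omega]
            have hval : ∀ u ∈ MM (Aop C y) (k+2-1), C (s+1) u = y • u := by
              intro u hu
              have := ih u hu
              simpa [Aop, sub_eq_zero] using this
            have hinv : C s v ∈ MM (Aop C y) (k+2-1) := by
              have : C s v = Aop C y s v + y • v := by simp [Aop]
              rw [this]
              exact Submodule.add_mem _ (le_MM s _ (by omega) (by omega) ⟨v, rfl⟩)
                (Submodule.smul_mem _ _ hv)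
            have hb := LinearMap.congr_fun (h.braid s (by omega) (by omega)) v
            simp only [End.mul_apply] at hb
            rw [hval _ hinv, hval _ hv] at hb
            simp only [map_smul] at hb
            rw [hval _ hinv] at hb
            have hb2 := smul_right_injective _ hy hb
            have hb3 : C s (C s v) = C s (y • v) := by rw [map_smul]; exact hb2
            have := h.inj s (by omega) (by omega) hb3
            simp [Aop, this]
        refine h.ext hm ?_
        intro i j p q a1 a2 a3 a4 a5 a6 a7 a8
        rw [← Aop_sub C y i j, ← Aop_sub C y p q]
        ext v
        have hv : (Aop C y p - Aop C y q) v ∈ MM (Aop C y) (k+2-1) :=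
          Submodule.sub_mem _ (le_MM p _ a5 (by omega) ⟨v, rfl⟩) (le_MM q _ a7 (by omega) ⟨v, rfl⟩)
        have k1 := kill (k+1-i) (by omega) _ hv
        have k2 := kill (k+1-j) (by omega) _ hv
        rw [show k+1-(k+1-i) = i by omega] at k1
        rw [show k+1-(k+1-j) = j by omega] at k2
        rw [End.mul_apply, LinearMap.sub_apply, k1, k2, sub_self]; rfl
    · have hlt : finrank ℂ (LinearMap.ker T) < finrank ℂ V := by
        apply Submodule.finrank_lt
        rw [Ne, LinearMap.ker_eq_top]
        exact hT0
      obtain ⟨C', hC', hcc⟩ := h.restr (LinearMap.ker T) (by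
        intro i a b w hw
        have := LinearMap.congr_fun (hT1 i a b) w
        rw [LinearMap.mem_ker] at hw ⊢
        simp only [End.mul_apply] at this
        rw [this, hw, map_zero])
      have hk := ihd (finrank ℂ (LinearMap.ker T)) (by omega) (LinearMap.ker T) C' hC' rfl (by omega)
      refine h.ext hm ?_
      intro i j p q a1 a2 a3 a4 a5 a6 a7 a8
      ext v
      have hv : (C p - C q) v ∈ LinearMap.ker T := by
        have e := LinearMap.congr_fun (hT2 p q a5 a6 a7 a8) v
        have e1 := LinearMap.congr_fun (hT1 p a5 a6) v
        have e2 := LinearMap.congr_fun (hT1 q a7 a8) v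
        simp only [End.mul_apply] at e e1 e2
        rw [LinearMap.mem_ker, LinearMap.sub_apply, map_sub, e1, e2]
        exact e
      have := congrArg Subtype.val (LinearMap.congr_fun (hk i j a1 a2 a3 a4) ⟨_, hv⟩)
      rw [hcc i a1 a2, hcc j a3 a4] at this
      rw [End.mul_apply, LinearMap.sub_apply (C i)]
      exact sub_eq_zero.2 this
  · push Not at hbig
    have c34 := commutant_comm (C 1) (C 3) (C 4) (h.comm 1 3 (by omega) (by omega) (by omega))
      (h.comm 1 4 (by omega) (by omega) (by omega)) (by
        intro μ
        by_cases hμ : μ = 0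
        · rw [hμ, zero_smul, sub_zero, LinearMap.ker_eq_bot.2 (h.inj 1 le_rfl (by omega))]
          simp
        · have h1 := hbig μ hμ
          have h2 := (Aop C μ 1).finrank_range_add_finrank_ker
          change finrank ℂ (LinearMap.ker (Aop C μ 1)) ≤ 1
          omega)
    exact h.all_eq 3 (by omega) (by omega) (eq_of_comm_braid (h.unit _ (by omega) (by omega))
      (h.unit _ (by omega) (by omega)) c34 (h.braid 3 (by omega) (by omega)))

theorem scalar_of_eq [FiniteDimensional ℂ V] [Nontrivial V] {m : ℕ} {C : ℕ → End ℂ V} (h : Br m C)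
    (hm : 2 ≤ m)
    (hirr : ∀ p : Submodule ℂ V,
      (∀ i, 1 ≤ i → i < m → ∀ v ∈ p, C i v ∈ p) → p = ⊥ ∨ p = ⊤)
    (he : ∀ i, 1 ≤ i → i < m → C i = C 1) : ∃ y : ℂ, y ≠ 0 ∧ Aop C y 1 = 0 := by
  obtain ⟨μ, hμ⟩ := Module.End.exists_eigenvalue (C 1)
  obtain ⟨v, hv⟩ := hμ.exists_hasEigenvector
  have hv1 := hv.apply_eq_smul
  refine ⟨μ, ?_, ?_⟩
  · rintro rfl
    rw [zero_smul] at hv1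
    exact hv.2 (h.inj 1 le_rfl (by omega) (by rw [hv1, map_zero]))
  · rcases hirr (LinearMap.ker (Aop C μ 1)) (by
      intro i a b w hw
      rw [he i a b]
      have := LinearMap.congr_fun (A_comm_C (C := C) (y := μ) (i := 1) (j := 1) rfl) w
      simp only [End.mul_apply] at this
      rw [LinearMap.mem_ker] at hw ⊢
      rw [this, hw, map_zero]) with hb | ht
    · exfalso
      apply hv.2
      have : v ∈ LinearMap.ker (Aop C μ 1) := by simp [Aop, hv1]
      rw [hb] at this
      simpa using this
    · exact LinearMap.ker_eq_top.1 ht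

theorem low_rank [FiniteDimensional ℂ V] {n : ℕ} {C : ℕ → End ℂ V} (h : Br n C)
    (hn : 10 ≤ n) (hr₁ : n + 1 ≤ finrank ℂ V) (hr₂ : finrank ℂ V ≤ 2 * n - 9)
    (hirr : ∀ p : Submodule ℂ V,
      (∀ i, 1 ≤ i → i < n → ∀ v ∈ p, C i v ∈ p) → p = ⊥ ∨ p = ⊤) :
    ∃ y : ℂ, y ≠ 0 ∧ finrank ℂ (LinearMap.range (Aop C y 1)) ≤ finrank ℂ V - n + 2 := by
  have : Nontrivial V := Module.nontrivial_of_finrank_pos (R := ℂ) (by omega)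
  have fin0 : (∃ y : ℂ, y ≠ 0 ∧ Aop C y 1 = 0) →
      ∃ y : ℂ, y ≠ 0 ∧ finrank ℂ (LinearMap.range (Aop C y 1)) ≤ finrank ℂ V - n + 2 := by
    rintro ⟨y, hy, h0⟩
    exact ⟨y, hy, by rw [h0, LinearMap.range_zero, finrank_bot]; omega⟩
  obtain ⟨k, rfl⟩ : ∃ k, n = k + 2 := ⟨n-2, by omega⟩
  by_cases hbig : ∃ y : ℂ, y ≠ 0 ∧ finrank ℂ (LinearMap.range (Aop C y 1)) + 3 ≤ k
  · obtain ⟨y, hy, hrk⟩ := hbig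
    obtain ⟨H1, H2⟩ := H12 (small k) h (by omega) y (by omega)
    obtain ⟨T, hT1, hT2, hT3⟩ := tlem h (by omega) y H1 H2
    rcases hirr (LinearMap.ker T) (by
        intro i a b w hw
        have := LinearMap.congr_fun (hT1 i a b) w
        rw [LinearMap.mem_ker] at hw ⊢
        simp only [End.mul_apply] at this
        rw [this, hw, map_zero]) with hb | ht
    · apply fin0
      refine scalar_of_eq h (by omega) hirr ?_
      intro i a b
      ext v
      have hu := (LinearMap.isUnit_iff_ker_eq_bot _).2 hb
      have := hT2 i 1 a b le_rfl (by omega)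
      rw [sub_mul, sub_eq_zero] at this
      rw [hu.mul_right_cancel this]
    · have hfar := hT3 (LinearMap.ker_eq_top.1 ht)
      have hker : MM (Aop C y) (k-1) ≤ LinearMap.ker (Aop C y (k+1)) := by
        refine MM_kill _ _ ?_
        intro l l1 l2
        rw [← A_comm_A (h.comm l _ l1 (by omega) (by omega))]
        exact hfar l _ l1 (by omega) (by omega)
      have hrk1 := h.rank_eq y (k+1) (by omega) (by omega)
      rcases chain h hy hfar (k-1) (by omega) (by omega) with hc | ⟨j, hj1, hj2, hj⟩
      · have h1 := Submodule.finrank_mono hker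
        have h2 := (Aop C y (k+1)).finrank_range_add_finrank_ker
        exact ⟨y, hy, by omega⟩
      · apply fin0
        refine ⟨y, hy, ?_⟩
        rcases hirr (MM (Aop C y) (k+2-1)) (by
          intro s s1 s2 v hv
          have : C s v = Aop C y s v + y • v := by simp [Aop]
          rw [this]
          exact Submodule.add_mem _ (le_MM s _ (by omega) (by omega) ⟨v, rfl⟩)
                (Submodule.smul_mem _ _ hv)) with hb | ht
        · apply LinearMap.range_eq_bot.1
          rw [eq_bot_iff, ← hb]
          exact le_MM 1 _ le_rfl (by omega)
        · have hle : MM (Aop C y) j ≤ MM (Aop C y) (k-1) :=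
            MM_le _ fun i a b => le_MM i _ a (by omega)
          rw [hj, ht] at hle
          have h0 : Aop C y (k+1) = 0 := LinearMap.ker_eq_top.1 (top_le_iff.1 (hle.trans hker))
          apply eq_smul_of_rank
          rw [← hrk1, h0]
          simp
  · push Not at hbig
    apply fin0
    refine scalar_of_eq h (by omega) hirr ?_
    have inv : ∀ μ i, C 1 * C i = C i * C 1 → ∀ w ∈ LinearMap.ker (Aop C μ 1),
        C i w ∈ LinearMap.ker (Aop C μ 1) := by
      intro μ i hc w hw
      have := LinearMap.congr_fun (A_comm_C (y := μ) hc) w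
      simp only [End.mul_apply] at this
      rw [LinearMap.mem_ker] at hw ⊢
      rw [this, hw, map_zero]
    have hg := glue k (by omega) _ V (fun i => C (i+2)) (C 1) rfl h.shift
      (fun i a b => h.comm 1 (i+2) (by omega) (by omega) (by omega))
      (by
        intro μ v hv
        by_cases hμ : μ = 0
        · have : v = 0 := by
            apply h.inj 1 le_rfl (by omega)
            rw [hv, hμ, zero_smul, map_zero]
          intros; rw [this, map_zero, map_zero]
        · have h1 := hbig μ hμ
          have h2 := (Aop C μ 1).finrank_range_add_finrank_ker
          refine (small k).sub h.shift (LinearMap.ker (Aop C μ 1)) ?_ (by omega) v ?_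
          · intro i a b
            exact inv μ _ (h.comm 1 (i+2) (by omega) (by omega) (by omega))
          · simp [Aop, hv])
    have h34 := hg 1 2 (by omega) (by omega) (by omega) (by omega)
    intro i a b
    exact h.all_eq 3 (by omega) (by omega) h34 i 1 a b le_rfl (by omega)

end BraidAux


/-- For `n ≥ 10` and an irreducible representation of `B_n` of dimension `r` with
`n+1 ≤ r ≤ 2n-9`, there exists `y ≠ 0` with `rank (C 1 - y • I) ≤ r - n + 2`. -/
theorem stmt_5 (n r : ℕ) (hn : 10 ≤ n) (hr₁ : n + 1 ≤ r) (hr₂ : r ≤ 2 * n - 9)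
    (C : ℕ → Matrix (Fin r) (Fin r) ℂ)
    (hinv : ∀ i, 1 ≤ i → i ≤ n - 1 → IsUnit (C i))
    (hcomm : ∀ i j, 1 ≤ i → i ≤ n - 1 → 1 ≤ j → j ≤ n - 1 → i + 2 ≤ j →
      C i * C j = C j * C i)
    (hbraid : ∀ i, 1 ≤ i → i ≤ n - 2 →
      C i * C (i + 1) * C i = C (i + 1) * C i * C (i + 1))
    (hirr : ∀ p : Submodule ℂ (Fin r → ℂ),
      (∀ i, 1 ≤ i → i ≤ n - 1 → ∀ v ∈ p, (C i).mulVec v ∈ p) → p = ⊥ ∨ p = ⊤) :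
    ∃ y : ℂ, y ≠ 0 ∧ (C 1 - y • (1 : Matrix (Fin r) (Fin r) ℂ)).rank ≤ r - n + 2 := by
  have hB : BraidAux.Br n (fun i => Matrix.toLin' (C i)) := by
    refine ⟨?_, ?_, ?_⟩
    · intro i h1 h2
      rw [Matrix.toLin'_apply']
      exact Matrix.mulVec_injective_iff_isUnit.2 (hinv i h1 (by omega))
    · intro i j h1 h2 h3
      show Matrix.toLin' (C i) ∘ₗ Matrix.toLin' (C j) = Matrix.toLin' (C j) ∘ₗ Matrix.toLin' (C i)
      rw [← Matrix.toLin'_mul, ← Matrix.toLin'_mul,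
        hcomm i j h1 (by omega) (by omega) (by omega) h2]
    · intro i h1 h2
      show (Matrix.toLin' (C i) ∘ₗ Matrix.toLin' (C (i+1))) ∘ₗ Matrix.toLin' (C i) =
        (Matrix.toLin' (C (i+1)) ∘ₗ Matrix.toLin' (C i)) ∘ₗ Matrix.toLin' (C (i+1))
      rw [← Matrix.toLin'_mul, ← Matrix.toLin'_mul, ← Matrix.toLin'_mul, ← Matrix.toLin'_mul,
        hbraid i h1 (by omega)]
  have hfr : Module.finrank ℂ (Fin r → ℂ) = r := by simp
  obtain ⟨y, hy, hle⟩ := BraidAux.low_rank hB hn (by omega) (by omega) (by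
    intro p hp
    refine hirr p ?_
    intro i h1 h2 v hv
    have := hp i h1 (by omega) v hv
    simpa using this)
  refine ⟨y, hy, ?_⟩
  rw [hfr] at hle
  have e : BraidAux.Aop (fun i => Matrix.toLin' (C i)) y 1 =
      (C 1 - y • (1 : Matrix (Fin r) (Fin r) ℂ)).mulVecLin := by
    rw [← Matrix.toLin'_apply', map_sub, map_smul, Matrix.toLin'_one]
    rfl
  rw [e] at hle
  exact hle
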